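/- Hahn–Banach extension theorem for normed modules: let (𝒰, U, V) be a countably representable (CR) metric f-structure, let M be a V-normed U-module, and let N ⊊ M be a V-normed U-submodule of M. Let f : N → V be a U-linear map and let p : M → V⁺ be a U-sublinear map such that f(v) ≤ p(v) for every v ∈ N. Then there exists a U-linear map f̄ : M → V such that f̄|_N = f and f̄(v) ≤ p(v) for every v ∈ M. -/

import Mathlib

/-- An `f`-algebra: a Riesz space (real vector space with a lattice order, addition
order-preserving, nonnegative scalar multiples of nonnegative elements nonnegative) endowed
with an associative, commutative, distributive multiplication with identity `1`, compatible
with scalar multiplication, such that products of nonnegative elements are nonnegative and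
the `f`-condition holds: `(a * c) ⊓ b = 0` whenever `a ⊓ b = 0` and `0 ≤ c`. -/
class FAlgebra (A : Type*) extends Lattice A, CommRing A, Module ℝ A where
  add_le_add_left' : ∀ a b : A, a ≤ b → ∀ c : A, c + a ≤ c + b
  smul_nonneg' : ∀ (r : ℝ) (a : A), 0 ≤ r → 0 ≤ a → 0 ≤ r • a
  smul_mul' : ∀ (r : ℝ) (a b : A), r • (a * b) = (r • a) * b
  mul_nonneg' : ∀ a b : A, 0 ≤ a → 0 ≤ b → 0 ≤ a * b
  f_cond : ∀ a b c : A, a ⊓ b = 0 → 0 ≤ c → (a * c) ⊓ b = 0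

/-- A family of elements of an `f`-algebra is pairwise disjoint if `|e i| ⊓ |e j| = 0`
for all `i ≠ j`, where `|a| := a ⊔ -a`. -/
def PairwiseDisjointFam {A : Type*} [FAlgebra A] {ι : Type*} (e : ι → A) : Prop :=
  ∀ i j, i ≠ j → ((e i) ⊔ -(e i)) ⊓ ((e j) ⊔ -(e j)) = 0

section MetricFStructure

variable {A : Type*} [FAlgebra A]

/-- The absolute value `|a| := a ⊔ -a` in a Riesz space. -/
def absR (a : A) : A := a ⊔ -a

/-- `a` is the least upper bound, among elements of `S`, of the subset `T`. -/
def IsLUBIn (S T : Set A) (a : A) : Prop :=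
  a ∈ S ∧ (∀ t ∈ T, t ≤ a) ∧ ∀ b ∈ S, (∀ t ∈ T, t ≤ b) → a ≤ b

/-- `a` is the greatest lower bound, among elements of `S`, of the subset `T`. -/
def IsGLBIn (S T : Set A) (a : A) : Prop :=
  a ∈ S ∧ (∀ t ∈ T, a ≤ t) ∧ ∀ b ∈ S, (∀ t ∈ T, b ≤ t) → b ≤ a

/-- Dedekind σ-completeness of the subset `S` with its induced order. -/
def SigmaDedekindOn (S : Set A) : Prop :=
  (∀ T : Set A, T ⊆ S → T.Nonempty → T.Countable → (∃ b ∈ S, ∀ t ∈ T, t ≤ b) →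
      ∃ a, IsLUBIn S T a) ∧
    ∀ T : Set A, T ⊆ S → T.Nonempty → T.Countable → (∃ b ∈ S, ∀ t ∈ T, b ≤ t) →
      ∃ a, IsGLBIn S T a

/-- An element of `S` is simple if it is a finite real linear combination `∑ c i • e i`
where `(e i)` is a finite partition of `1` consisting of idempotents of `S`. -/
def IsSimpleIn (S : Set A) (a : A) : Prop :=
  ∃ (n : ℕ) (c : Fin n → ℝ) (e : Fin n → A),
    (∀ i, e i ∈ S) ∧ (∀ i, e i * e i = e i) ∧ PairwiseDisjointFam e ∧
      (∑ i, e i) = 1 ∧ a = ∑ i, c i • e i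

/-- A countable partition of `1` inside `S`: a sequence of pairwise disjoint idempotents
of `S` whose supremum in `S` is `1`. -/
def IsPartitionOfOneIn (S : Set A) (e : ℕ → A) : Prop :=
  (∀ n, e n ∈ S) ∧ (∀ n, e n * e n = e n) ∧ PairwiseDisjointFam e ∧
    IsLUBIn S (Set.range e) 1

/-- Localisability of the whole `f`-algebra `A`: Dedekind σ-completeness,
σ-order-continuity of the multiplication on nonnegative pairs, and super-order-density
of the simple elements. -/
structure IsLocalisable (A : Type*) [FAlgebra A] : Prop where
  lub : ∀ S : Set A, S.Nonempty → S.Countable → BddAbove S → ∃ a, IsLUB S a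
  glb : ∀ S : Set A, S.Nonempty → S.Countable → BddBelow S → ∃ a, IsGLB S a
  mul_scont : ∀ (a b : ℕ → A) (x y : A), (∀ n, 0 ≤ a n) → (∀ n, 0 ≤ b n) →
    Monotone a → Monotone b → IsLUB (Set.range a) x → IsLUB (Set.range b) y →
    IsLUB (Set.range fun n => a n * b n) (x * y)
  simple_dense : ∀ x : A, 0 ≤ x → ∃ s : ℕ → A, Monotone s ∧ (∀ n, 0 ≤ s n) ∧
    (∀ n, IsSimpleIn Set.univ (s n)) ∧ IsLUB (Set.range s) x

/-- `d` is a complete distance on the subset `S`. -/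
structure IsCompleteDistOn (S : Set A) (d : A → A → ℝ) : Prop where
  refl : ∀ a ∈ S, d a a = 0
  comm : ∀ a ∈ S, ∀ b ∈ S, d a b = d b a
  triangle : ∀ a ∈ S, ∀ b ∈ S, ∀ c ∈ S, d a c ≤ d a b + d b c
  eq_of_dist : ∀ a ∈ S, ∀ b ∈ S, d a b = 0 → a = b
  complete : ∀ f : ℕ → A, (∀ n, f n ∈ S) →
    (∀ ε : ℝ, 0 < ε → ∃ N : ℕ, ∀ m ≥ N, ∀ n ≥ N, d (f m) (f n) < ε) →
    ∃ a ∈ S, ∀ ε : ℝ, 0 < ε → ∃ N : ℕ, ∀ n ≥ N, d (f n) a < ε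

/-- `S` is a metric Riesz space inside `A` with complete distance `d`: a Dedekind
σ-complete Riesz subspace such that `d a 0 = d |a| 0`, `d` is translation-invariant,
and `d · 0` is order-preserving on nonnegative elements. -/
structure IsMetricRieszOn (S : Set A) (d : A → A → ℝ) : Prop where
  zero_mem : (0 : A) ∈ S
  add_mem : ∀ a ∈ S, ∀ b ∈ S, a + b ∈ S
  smul_mem : ∀ (r : ℝ), ∀ a ∈ S, r • a ∈ S
  sup_mem : ∀ a ∈ S, ∀ b ∈ S, a ⊔ b ∈ S
  inf_mem : ∀ a ∈ S, ∀ b ∈ S, a ⊓ b ∈ S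
  sigmaDedekind : SigmaDedekindOn S
  dist : IsCompleteDistOn S d
  dist_abs : ∀ a ∈ S, d a 0 = d (absR a) 0
  translation : ∀ a ∈ S, ∀ b ∈ S, ∀ c ∈ S, d a b = d (a + c) (b + c)
  mono : ∀ a ∈ S, ∀ b ∈ S, 0 ≤ a → a ≤ b → d a 0 ≤ d b 0

/-- `S` is a metric `f`-algebra inside `A` with distance `d`: a metric Riesz space which
is a localisable `f`-subalgebra (σ-order-continuous multiplication, simple elements
super-order-dense), the multiplication is `d`-continuous, the simple elements are
`d`-dense, and `d (ε • 1) 0 → 0` as `ε ↓ 0`. -/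
structure IsMetricFAlgebraOn (S : Set A) (d : A → A → ℝ)
    extends IsMetricRieszOn S d : Prop where
  one_mem : (1 : A) ∈ S
  mul_mem : ∀ a ∈ S, ∀ b ∈ S, a * b ∈ S
  mul_scont : ∀ (a b : ℕ → A) (x y : A), (∀ n, a n ∈ S) → (∀ n, b n ∈ S) →
    (∀ n, 0 ≤ a n) → (∀ n, 0 ≤ b n) → Monotone a → Monotone b →
    IsLUBIn S (Set.range a) x → IsLUBIn S (Set.range b) y →
    IsLUBIn S (Set.range fun n => a n * b n) (x * y)
  simple_order_dense : ∀ x ∈ S, 0 ≤ x → ∃ s : ℕ → A, Monotone s ∧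
    (∀ n, s n ∈ S ∧ 0 ≤ s n ∧ IsSimpleIn S (s n)) ∧ IsLUBIn S (Set.range s) x
  mul_cont : ∀ (a b : ℕ → A) (x y : A), (∀ n, a n ∈ S) → (∀ n, b n ∈ S) → x ∈ S → y ∈ S →
    (∀ ε : ℝ, 0 < ε → ∃ N : ℕ, ∀ n ≥ N, d (a n) x < ε) →
    (∀ ε : ℝ, 0 < ε → ∃ N : ℕ, ∀ n ≥ N, d (b n) y < ε) →
    ∀ ε : ℝ, 0 < ε → ∃ N : ℕ, ∀ n ≥ N, d (a n * b n) (x * y) < ε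
  simple_metric_dense : ∀ x ∈ S, ∀ ε : ℝ, 0 < ε → ∃ s, IsSimpleIn S s ∧ d x s < ε
  one_small : ∀ ε : ℝ, 0 < ε → ∃ δ : ℝ, 0 < δ ∧ ∀ r : ℝ, 0 < r → r < δ → d (r • (1 : A)) 0 < ε

/-- A metric `f`-structure `(A, U, V)`: `A` is a localisable ambient `f`-algebra, `U` a
solid metric `f`-subalgebra with distance `dU`, `V` a solid metric Riesz subspace with
distance `dV`, `U * V = V` with jointly continuous multiplication, and the uniform glueing
axiom along countable partitions of `1` holds. -/
structure IsMetricFStructure (U V : Set A) (dU dV : A → A → ℝ) : Prop where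
  ambient : IsLocalisable A
  U_falg : IsMetricFAlgebraOn U dU
  U_solid : ∀ x : A, ∀ u ∈ U, absR x ≤ absR u → x ∈ U
  V_riesz : IsMetricRieszOn V dV
  V_solid : ∀ x : A, ∀ v ∈ V, absR x ≤ absR v → x ∈ V
  mul_mem_UV : ∀ u ∈ U, ∀ v ∈ V, u * v ∈ V
  V_eq_UV : ∀ v ∈ V, ∃ u ∈ U, ∃ w ∈ V, v = u * w
  mul_cont_UV : ∀ (a b : ℕ → A) (x y : A), (∀ n, a n ∈ U) → (∀ n, b n ∈ V) →
    x ∈ U → y ∈ V →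
    (∀ ε : ℝ, 0 < ε → ∃ N : ℕ, ∀ n ≥ N, dU (a n) x < ε) →
    (∀ ε : ℝ, 0 < ε → ∃ N : ℕ, ∀ n ≥ N, dV (b n) y < ε) →
    ∀ ε : ℝ, 0 < ε → ∃ N : ℕ, ∀ n ≥ N, dV (a n * b n) (x * y) < ε
  glueing_axiom : ∀ e : ℕ → A, IsPartitionOfOneIn U e → ∀ ε : ℝ, 0 < ε →
    ∃ δ : ℝ, 0 < δ ∧ ∀ v : ℕ → A, (∀ n, v n ∈ V ∧ 0 ≤ v n) →
      Summable (fun n => dV (e n * v n) 0) → (∑' n, dV (e n * v n) 0) ≤ δ →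
      ∃ s, IsLUBIn V (Set.range fun n => e n * v n) s ∧ dV s 0 ≤ ε

/-- Countable representability of the subset `S` with its induced order (in particular,
`S` is Dedekind complete). -/
def CROn (S : Set A) : Prop :=
  (∀ T : Set A, T ⊆ S → T.Nonempty → (∃ b ∈ S, ∀ t ∈ T, t ≤ b) →
      ∃ (a : A) (f : ℕ → A), (∀ n, f n ∈ T) ∧ IsLUBIn S T a ∧ IsLUBIn S (Set.range f) a) ∧
    ∀ T : Set A, T ⊆ S → T.Nonempty → (∃ b ∈ S, ∀ t ∈ T, b ≤ t) →
      ∃ (a : A) (f : ℕ → A), (∀ n, f n ∈ T) ∧ IsGLBIn S T a ∧ IsGLBIn S (Set.range f) a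

/-- A `V`-normed `U`-module: an additive group `M` with a `U`-scalar multiplication
`smul` and pointwise norm `nrm : M → V⁺` satisfying the pointwise norm axioms and the
glueing property along countable partitions of `1`. -/
structure IsNormedModule (U V : Set A) (dV : A → A → ℝ)
    (M : Type*) [AddCommGroup M] (smul : A → M → M) (nrm : M → A) : Prop where
  smul_add : ∀ u ∈ U, ∀ v w : M, smul u (v + w) = smul u v + smul u w
  add_smul : ∀ u ∈ U, ∀ u' ∈ U, ∀ v : M, smul (u + u') v = smul u v + smul u' v
  mul_smul : ∀ u ∈ U, ∀ u' ∈ U, ∀ v : M, smul (u * u') v = smul u (smul u' v)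
  one_smul : ∀ v : M, smul 1 v = v
  nrm_mem : ∀ v : M, nrm v ∈ V
  nrm_nonneg : ∀ v : M, 0 ≤ nrm v
  nrm_eq_zero : ∀ v : M, nrm v = 0 ↔ v = 0
  nrm_add_le : ∀ v w : M, nrm (v + w) ≤ nrm v + nrm w
  nrm_smul : ∀ u ∈ U, ∀ v : M, nrm (smul u v) = absR u * nrm v
  glueing : ∀ e : ℕ → A, IsPartitionOfOneIn U e → ∀ v : ℕ → M,
    (∃ b ∈ V, ∀ n, nrm (smul (e n) (v n)) ≤ b) →
    ∃ z : M, ∀ n, smul (e n) z = smul (e n) (v n)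

end MetricFStructure

section SublinearExtension

variable {E A : Type*} [AddCommGroup E] [Module ℝ E]
  [AddCommGroup A] [PartialOrder A] [IsOrderedAddMonoid A] [Module ℝ A] [PosSMulMono ℝ A]

/-- One-dimensional step of the Hahn–Banach–Kantorovich theorem. -/
theorem LinearPMap.exists_lt_of_le_sublinear
    (hA : ∀ S : Set A, S.Nonempty → BddAbove S → ∃ a, IsLUB S a)
    (p : E → A) (hp_add : ∀ x y, p (x + y) ≤ p x + p y)
    (hp_smul : ∀ r : ℝ, 0 ≤ r → ∀ x, p (r • x) = r • p x)
    (f : E →ₗ.[ℝ] A) (hf : ∀ x : f.domain, f x ≤ p x) (hdom : f.domain ≠ ⊤) :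
    ∃ g, f < g ∧ ∀ x : g.domain, g x ≤ p x := by
  obtain ⟨y, -, hy⟩ := SetLike.exists_of_lt hdom.lt_top
  have hsep : ∀ x z : f.domain, f x - p (x - y) ≤ p (z + y) - f z := fun x z => by
    rw [sub_le_iff_le_add, sub_add_eq_add_sub, le_sub_iff_add_le, ← f.map_add]
    refine (hf _).trans ?_
    have h := hp_add (z + y) (x - y)
    rwa [show (z + y + (x - y) : E) = ((x + z : f.domain) : E) by push_cast; abel] at h
  obtain ⟨c, hc⟩ := hA (Set.range fun x : f.domain => f x - p (x - y)) (Set.range_nonempty _)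
    ⟨p ((0 : f.domain) + y) - f 0, by rintro _ ⟨x, rfl⟩; exact hsep x 0⟩
  have hlow : ∀ x : f.domain, f x - c ≤ p (x - y) := fun x => by
    have := hc.1 ⟨x, rfl⟩
    rw [sub_le_iff_le_add] at this ⊢
    rwa [add_comm]
  have hup : ∀ x : f.domain, f x + c ≤ p (x + y) := fun x => by
    rw [← le_sub_iff_add_le']
    exact hc.2 (by rintro _ ⟨z, rfl⟩; exact hsep z x)
  refine ⟨f.supSpanSingleton y c hy, ?_, ?_⟩
  · refine lt_iff_le_not_ge.2 ⟨f.left_le_sup _ _, fun H => ?_⟩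
    replace H := LinearPMap.domain_mono.monotone H
    rw [LinearPMap.domain_supSpanSingleton, sup_le_iff, Submodule.span_le,
      Set.singleton_subset_iff] at H
    exact hy H.2
  · rintro ⟨z, hz⟩
    rcases Submodule.mem_sup.1 hz with ⟨x, hx, y', hy', rfl⟩
    rcases Submodule.mem_span_singleton.1 hy' with ⟨r, rfl⟩
    rw [LinearPMap.supSpanSingleton_apply_mk _ _ _ _ _ hx]
    change f ⟨x, hx⟩ + r • c ≤ p (x + r • y)
    have key : ∀ (s : ℝ), 0 < s → ∀ (b : A) (w : E), (∀ x : f.domain, f x + b ≤ p (x + w)) →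
        f ⟨x, hx⟩ + s • b ≤ p (x + s • w) := fun s hs b w h => by
      have h' := smul_le_smul_of_nonneg_left (h (s⁻¹ • ⟨x, hx⟩)) hs.le
      rwa [f.map_smul, smul_add, smul_inv_smul₀ hs.ne', ← hp_smul s hs.le, smul_add,
        Submodule.coe_smul, smul_inv_smul₀ hs.ne'] at h'
    rcases lt_trichotomy r 0 with hr | rfl | hr
    · have := key (-r) (neg_pos.2 hr) (-c) (-y) fun x => by
        simpa only [← sub_eq_add_neg] using hlow x
      simpa only [neg_smul_neg] using this
    · simpa using hf ⟨x, hx⟩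
    · exact key r hr c y hup

/-- **Hahn–Banach–Kantorovich theorem**: a linear map into a Dedekind complete ordered real
vector space which is dominated by a sublinear map extends to the whole space. -/
theorem LinearPMap.exists_extension_of_le_sublinear
    (hA : ∀ S : Set A, S.Nonempty → BddAbove S → ∃ a, IsLUB S a)
    (p : E → A) (hp_add : ∀ x y, p (x + y) ≤ p x + p y)
    (hp_smul : ∀ r : ℝ, 0 ≤ r → ∀ x, p (r • x) = r • p x)
    (f : E →ₗ.[ℝ] A) (hf : ∀ x : f.domain, f x ≤ p x) :
    ∃ g : E →ₗ[ℝ] A, (∀ x : f.domain, g x = f x) ∧ ∀ x, g x ≤ p x := by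
  obtain ⟨q, hfq, hq⟩ := zorn_le_nonempty₀ { q : E →ₗ.[ℝ] A | ∀ x : q.domain, q x ≤ p x }
    (fun c hcs hc y hy => by
      have hdir : DirectedOn (· ≤ ·) c := hc.directedOn
      refine ⟨LinearPMap.sSup c hdir, ?_, fun _ => LinearPMap.le_sSup hdir⟩
      rintro ⟨x, hx⟩
      obtain ⟨_, ⟨q, hqc, rfl⟩, hxq⟩ := (Submodule.mem_sSup_of_directed
        (Set.Nonempty.image _ ⟨y, hy⟩) (hdir.mono_comp LinearPMap.domain_mono.monotone)).1 hx
      rw [← (LinearPMap.le_sSup hdir hqc).2 (x := ⟨x, hxq⟩) rfl]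
      exact hcs hqc ⟨x, hxq⟩) f hf
  have htop : q.domain = ⊤ := by
    by_contra h
    obtain ⟨g, hqg, hg⟩ := q.exists_lt_of_le_sublinear hA p hp_add hp_smul hq.prop h
    exact hqg.not_ge (hq.2 hg hqg.le)
  refine ⟨q.toFun ∘ₗ (LinearEquiv.ofTop _ htop).symm.toLinearMap, fun x => ?_, fun x => ?_⟩
  · exact (hfq.2 rfl).symm
  · exact hq.prop _

end SublinearExtension

section FAlgebraLemmas

variable {A : Type*} [FAlgebra A]

instance FAlgebra.instIsOrderedAddMonoid : IsOrderedAddMonoid A where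
  add_le_add_left a b h c := by
    simpa only [add_comm] using FAlgebra.add_le_add_left' a b h c

instance FAlgebra.instPosSMulMono : PosSMulMono ℝ A where
  smul_le_smul_of_nonneg_left r hr a b h := by
    have := FAlgebra.smul_nonneg' r (b - a) hr (sub_nonneg.2 h)
    rwa [smul_sub, sub_nonneg] at this

theorem FAlgebra.mul_le_mul_left_of_nonneg {a b c : A} (h : a ≤ b) (hc : 0 ≤ c) :
    c * a ≤ c * b := by
  have := FAlgebra.mul_nonneg' c (b - a) hc (sub_nonneg.2 h)
  rwa [mul_sub, sub_nonneg] at this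

theorem FAlgebra.smul_one_mul (r : ℝ) (a : A) : (r • (1 : A)) * a = r • a := by
  rw [← FAlgebra.smul_mul', one_mul]

theorem FAlgebra.mul_eq_zero_of_inf_eq_zero {a b : A} (h : a ⊓ b = 0) : a * b = 0 := by
  have ha : 0 ≤ a := h ▸ inf_le_left
  have hb : 0 ≤ b := h ▸ inf_le_right
  have h1 := FAlgebra.f_cond a b b h hb
  rw [inf_comm] at h1
  have h2 := FAlgebra.f_cond b (a * b) a h1 ha
  rwa [mul_comm b a, inf_idem] at h2

theorem FAlgebra.mul_self_nonneg (a : A) : 0 ≤ a * a := by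
  have h : a⁺ * a⁻ = 0 := FAlgebra.mul_eq_zero_of_inf_eq_zero (posPart_inf_negPart_eq_zero a)
  have h2 : a * a = a⁺ * a⁺ + a⁻ * a⁻ := by
    conv_lhs => rw [← posPart_sub_negPart a]
    linear_combination (-2 : A) * h
  rw [h2]
  exact add_nonneg (FAlgebra.mul_nonneg' _ _ (posPart_nonneg a) (posPart_nonneg a))
    (FAlgebra.mul_nonneg' _ _ (negPart_nonneg a) (negPart_nonneg a))

theorem FAlgebra.mul_le_absR_mul {u x w : A} (h : x ≤ w) (h' : -x ≤ w) :
    u * x ≤ absR u * w := by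
  have h1 := FAlgebra.mul_le_mul_left_of_nonneg h (posPart_nonneg u)
  have h2 := FAlgebra.mul_le_mul_left_of_nonneg h' (negPart_nonneg u)
  calc u * x = u⁺ * x + u⁻ * -x := by
        conv_lhs => rw [← posPart_sub_negPart u]
        ring
    _ ≤ u⁺ * w + u⁻ * w := add_le_add h1 h2
    _ = absR u * w := by rw [← add_mul, posPart_add_negPart]; rfl

end FAlgebraLemmas

section NormedModule

variable {A : Type*} [FAlgebra A] {U V : Set A} {dU dV : A → A → ℝ}

theorem IsMetricRieszOn.dist_nonneg (hV : IsMetricRieszOn V dV) {a : A} (ha : a ∈ V) :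
    0 ≤ dV a 0 := by
  have h1 := hV.dist.triangle a ha 0 hV.zero_mem a ha
  rw [hV.dist.refl a ha, hV.dist.comm 0 hV.zero_mem a ha] at h1
  linarith

theorem IsMetricFAlgebraOn.smul_one_mem (hU : IsMetricFAlgebraOn U dU) (r : ℝ) :
    r • (1 : A) ∈ U := hU.smul_mem r 1 hU.one_mem

theorem IsMetricFAlgebraOn.neg_mem (hU : IsMetricFAlgebraOn U dU) {a : A} (ha : a ∈ U) :
    -a ∈ U := by
  simpa using hU.smul_mem (-1) a ha

theorem IsMetricFAlgebraOn.sub_mem (hU : IsMetricFAlgebraOn U dU) {a b : A} (ha : a ∈ U)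
    (hb : b ∈ U) : a - b ∈ U := by
  rw [sub_eq_add_neg]
  exact hU.add_mem _ ha _ (hU.neg_mem hb)

theorem IsMetricFAlgebraOn.posPart_mem (hU : IsMetricFAlgebraOn U dU) {a : A} (ha : a ∈ U) :
    a⁺ ∈ U := hU.sup_mem _ ha _ hU.zero_mem

theorem IsMetricFAlgebraOn.negPart_mem (hU : IsMetricFAlgebraOn U dU) {a : A} (ha : a ∈ U) :
    a⁻ ∈ U := hU.sup_mem _ (hU.neg_mem ha) _ hU.zero_mem

/-- An element of `V` dominated by `absR (u - s) * w` for every simple `s` vanishes. -/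
theorem IsMetricFStructure.eq_zero_of_absR_le (hstr : IsMetricFStructure U V dU dV)
    {u w z : A} (hu : u ∈ U) (hw : w ∈ V) (hz : z ∈ V)
    (h : ∀ s ∈ U, IsSimpleIn U s → absR z ≤ absR (u - s) * w) : z = 0 := by
  have hU := hstr.U_falg
  have hV := hstr.V_riesz
  have hsU : ∀ s, IsSimpleIn U s → s ∈ U := by
    rintro s ⟨n, c, e, he, -, -, -, rfl⟩
    exact Finset.sum_induction _ (· ∈ U) (fun a b ha hb => hU.add_mem a ha b hb) hU.zero_mem
      fun i _ => hU.smul_mem _ _ (he i)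
  choose s hs hsu using fun n : ℕ => hU.simple_metric_dense u hu (1 / ((n : ℝ) + 1)) (by positivity)
  have hmem : ∀ n, u - s n ∈ U := fun n => hU.sub_mem hu (hsU _ (hs n))
  have habs : ∀ n, absR (u - s n) ∈ U := fun n => hU.sup_mem _ (hmem n) _ (hU.neg_mem (hmem n))
  have hlim := hstr.mul_cont_UV (fun n => absR (u - s n)) (fun _ => w) 0 w habs (fun _ => hw)
    hU.zero_mem hw
    (fun ε hε => by
      obtain ⟨k, hk⟩ := exists_nat_one_div_lt hε
      refine ⟨k, fun n hn => ?_⟩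
      rw [← hU.dist_abs _ (hmem n), hU.translation _ (hmem n) _ hU.zero_mem _ (hsU _ (hs n)),
        sub_add_cancel, zero_add]
      exact ((hsu n).trans_le (Nat.one_div_le_one_div hn)).trans hk)
    (fun ε hε => ⟨0, fun n _ => by rwa [hV.dist.refl w hw]⟩)
  refine hV.dist.eq_of_dist z hz 0 hV.zero_mem (le_antisymm (le_of_forall_pos_lt_add ?_)
    (hV.dist_nonneg hz))
  intro ε hε
  obtain ⟨n, hn⟩ := hlim ε hε
  have h1 := hn n le_rfl
  rw [zero_mul] at h1
  rw [zero_add, hV.dist_abs z hz]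
  refine (hV.mono _ ?_ _ (hstr.mul_mem_UV _ (habs n) _ hw) ?_ (h _ (hsU _ (hs n)) (hs n))).trans_lt
    h1
  · exact hstr.V_solid _ z hz (le_of_eq (abs_abs z))
  · exact abs_nonneg z

variable {M : Type*} [AddCommGroup M] {smul : A → M → M} {nrm : M → A}

theorem IsNormedModule.neg_smul (hM : IsNormedModule U V dV M smul nrm)
    (hU : IsMetricFAlgebraOn U dU) {u : A} (hu : u ∈ U) (v : M) :
    smul (-u) v = -smul u v := by
  have h0 : smul 0 v = 0 := by
    simpa using hM.add_smul 0 hU.zero_mem 0 hU.zero_mem v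
  have h := hM.add_smul (-u) (hU.neg_mem hu) u hu v
  rw [neg_add_cancel, h0] at h
  exact eq_neg_of_add_eq_zero_left h.symm

theorem IsNormedModule.smul_neg (hM : IsNormedModule U V dV M smul nrm)
    {u : A} (hu : u ∈ U) (v : M) : smul u (-v) = -smul u v := by
  have h0 : smul u 0 = 0 := by
    simpa using hM.smul_add u hu 0 0
  have h := hM.smul_add u hu (-v) v
  rw [neg_add_cancel, h0] at h
  exact eq_neg_of_add_eq_zero_left h.symm

/-- The real vector space structure underlying a normed module. -/
@[reducible] def IsNormedModule.realModule (hM : IsNormedModule U V dV M smul nrm)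
    (hU : IsMetricFAlgebraOn U dU) : Module ℝ M :=
  letI : SMul ℝ M := ⟨fun r v => smul (r • (1 : A)) v⟩
  Module.ofMinimalAxioms
    (fun r v w => hM.smul_add _ (hU.smul_one_mem r) v w)
    (fun r s v => (congrArg (smul · v) (_root_.add_smul r s (1 : A))).trans
      (hM.add_smul _ (hU.smul_one_mem r) _ (hU.smul_one_mem s) v))
    (fun r s v => (congrArg (smul · v) (by
        rw [FAlgebra.smul_one_mul, SemigroupAction.mul_smul])).trans
      (hM.mul_smul _ (hU.smul_one_mem r) _ (hU.smul_one_mem s) v))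
    (fun v => (congrArg (smul · v) (_root_.one_smul ℝ (1 : A))).trans (hM.one_smul v))

/-- Any real-linear map dominated by a `U`-sublinear map is `U`-linear. -/
theorem IsNormedModule.map_smul_of_le_sublinear (hM : IsNormedModule U V dV M smul nrm)
    (hstr : IsMetricFStructure U V dU dV)
    {p : M → A} (hp_mem : ∀ v, p v ∈ V)
    (hp_nonneg : ∀ v, 0 ≤ p v) (hp_add : ∀ v w, p (v + w) ≤ p v + p w)
    (hp_smul : ∀ u ∈ U, 0 ≤ u → ∀ v, p (smul u v) = u * p v)
    {g : M → A} (hg_mem : ∀ v, g v ∈ V)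
    (hg_add : ∀ v w, g (v + w) = g v + g w)
    (hg_smul : ∀ (r : ℝ) v, g (smul (r • (1 : A)) v) = r • g v)
    (hgp : ∀ v, g v ≤ p v) {u : A} (hu : u ∈ U) (v : M) :
    g (smul u v) = u * g v := by
  have hU := hstr.U_falg
  have hg_neg : ∀ v, g (-v) = -g v := map_neg (AddMonoidHom.mk' g hg_add)
  set w := p v + p (-v)
  have hwV : w ∈ V := hstr.V_riesz.add_mem _ (hp_mem _) _ (hp_mem _)
  have hpw : p v ≤ w := le_add_of_nonneg_right (hp_nonneg _)
  have hpw' : p (-v) ≤ w := le_add_of_nonneg_left (hp_nonneg _)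
  have hgw : g v ≤ w := (hgp v).trans hpw
  have hgw' : -g v ≤ w := hg_neg v ▸ (hgp (-v)).trans hpw'
  have hbound : ∀ u ∈ U, g (smul u v) ≤ absR u * w := fun u hu => by
    have hsplit : smul u v = smul u⁺ v + smul u⁻ (-v) := by
      rw [hM.smul_neg (hU.negPart_mem hu), ← hM.neg_smul hU (hU.negPart_mem hu),
        ← hM.add_smul _ (hU.posPart_mem hu) _ (hU.neg_mem (hU.negPart_mem hu)),
        ← sub_eq_add_neg, posPart_sub_negPart]
    calc g (smul u v) ≤ p (smul u⁺ v) + p (smul u⁻ (-v)) :=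
          (hgp _).trans (hsplit ▸ hp_add _ _)
      _ = u⁺ * p v + u⁻ * p (-v) := by
          rw [hp_smul _ (hU.posPart_mem hu) (posPart_nonneg u),
            hp_smul _ (hU.negPart_mem hu) (negPart_nonneg u)]
      _ ≤ u⁺ * w + u⁻ * w :=
          add_le_add (FAlgebra.mul_le_mul_left_of_nonneg hpw (posPart_nonneg u))
            (FAlgebra.mul_le_mul_left_of_nonneg hpw' (negPart_nonneg u))
      _ = absR u * w := by rw [← add_mul, posPart_add_negPart]; rfl
  have hbound' : ∀ u ∈ U, -g (smul u v) ≤ absR u * w := fun u hu => by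
    have h := hbound (-u) (hU.neg_mem hu)
    rw [hM.neg_smul hU hu, hg_neg] at h
    simpa only [absR, neg_neg, sup_comm] using h
  have hcompl : ∀ e ∈ U, e * e = e → (1 - e) * g (smul e v) = 0 := fun e he hee => by
    have he0 : 0 ≤ e := hee ▸ FAlgebra.mul_self_nonneg e
    have he1 : 0 ≤ 1 - e := by
      have := FAlgebra.mul_self_nonneg (1 - e)
      rwa [show (1 - e) * (1 - e) = 1 - e by linear_combination hee] at this
    have habs : absR e = e := abs_of_nonneg he0
    have hz : (1 - e) * (absR e * w) = 0 := by
      rw [habs]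
      linear_combination (-w) * hee
    refine le_antisymm (hz ▸ FAlgebra.mul_le_mul_left_of_nonneg (hbound e he) he1) ?_
    have := hz ▸ FAlgebra.mul_le_mul_left_of_nonneg (hbound' e he) he1
    rwa [mul_neg, neg_nonpos] at this
  have hidem : ∀ e ∈ U, e * e = e → g (smul e v) = e * g v := fun e he hee => by
    have hsub : 1 - e ∈ U := hU.sub_mem hU.one_mem he
    have h1 := hcompl e he hee
    have h2 := hcompl (1 - e) hsub (by linear_combination hee)
    have h3 : g v = g (smul e v) + g (smul (1 - e) v) := by
      rw [← hg_add, ← hM.add_smul e he _ hsub, add_sub_cancel, hM.one_smul]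
    linear_combination h1 - h2 - e * h3
  have hsimple : ∀ s, IsSimpleIn U s → g (smul s v) = s * g v := by
    let P : Submodule ℝ A :=
      { carrier := {u | u ∈ U ∧ g (smul u v) = u * g v}
        add_mem' := fun {a b} ha hb => ⟨hU.add_mem _ ha.1 _ hb.1, by
          rw [hM.add_smul _ ha.1 _ hb.1, hg_add, ha.2, hb.2, add_mul]⟩
        zero_mem' := ⟨hU.zero_mem, by
          have := hg_smul 0 v
          rw [zero_smul, zero_smul] at this
          rw [this, zero_mul]⟩
        smul_mem' := fun r a ha => ⟨hU.smul_mem _ _ ha.1, by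
          rw [← FAlgebra.smul_one_mul r a, hM.mul_smul _ (hU.smul_one_mem r) _ ha.1, hg_smul, ha.2,
            mul_assoc, FAlgebra.smul_one_mul]⟩ }
    rintro s ⟨n, c, e, heU, hee, -, -, rfl⟩
    exact (P.sum_mem fun i _ => P.smul_mem (c i) ⟨heU i, hidem _ (heU i) (hee i)⟩).2
  have hneg_mem : ∀ a ∈ V, -a ∈ V := fun a ha => by
    simpa using hstr.V_riesz.smul_mem (-1) a ha
  refine sub_eq_zero.1 (hstr.eq_zero_of_absR_le (w := w + w) hu
    (hstr.V_riesz.add_mem _ hwV _ hwV) ?_ ?_)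
  · rw [sub_eq_add_neg]
    exact hstr.V_riesz.add_mem _ (hg_mem _) _ (hneg_mem _ (hstr.mul_mem_UV _ hu _ (hg_mem _)))
  · intro s hsU hs
    have hus : u - s ∈ U := hU.sub_mem hu hsU
    have hdec : g (smul u v) - u * g v = g (smul (u - s) v) + (u - s) * -g v := by
      have h1 : g (smul u v) = g (smul (u - s) v) + g (smul s v) := by
        rw [← hg_add, ← hM.add_smul _ hus _ hsU, sub_add_cancel]
      rw [h1, hsimple s hs]
      ring
    rw [hdec, mul_add]
    refine sup_le (add_le_add (hbound _ hus) (FAlgebra.mul_le_absR_mul hgw' (by rwa [neg_neg]))) ?_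
    rw [neg_add, mul_neg, neg_neg]
    exact add_le_add (hbound' _ hus) (FAlgebra.mul_le_absR_mul hgw hgw')

end NormedModule

/-- Hahn–Banach extension theorem for normed modules: let `(A, U, V)` be a
CR metric `f`-structure, `M` a `V`-normed `U`-module, `N ⊊ M` a `V`-normed `U`-submodule,
`f : N → V` a `U`-linear map and `p : M → V⁺` a `U`-sublinear map with `f ≤ p` on `N`.
Then there is a `U`-linear map `g : M → V` extending `f` with `g ≤ p` on all of `M`. -/
theorem hahn_banach_normed_modules {A : Type*} [FAlgebra A]
    {U V : Set A} {dU dV : A → A → ℝ}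
    (hstr : IsMetricFStructure U V dU dV)
    (hCR_ambient : CROn (Set.univ : Set A)) (hCR_U : CROn U) (hCR_V : CROn V)
    {M : Type*} [AddCommGroup M] (smul : A → M → M) (nrm : M → A)
    (hM : IsNormedModule U V dV M smul nrm)
    (N : Set M)
    (hN_zero : (0 : M) ∈ N)
    (hN_add : ∀ v ∈ N, ∀ w ∈ N, v + w ∈ N)
    (hN_neg : ∀ v ∈ N, -v ∈ N)
    (hN_smul : ∀ u ∈ U, ∀ v ∈ N, smul u v ∈ N)
    (hN_glue : ∀ e : ℕ → A, IsPartitionOfOneIn U e → ∀ v : ℕ → M, (∀ n, v n ∈ N) →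
      (∃ b ∈ V, ∀ n, nrm (smul (e n) (v n)) ≤ b) →
      ∀ z : M, (∀ n, smul (e n) z = smul (e n) (v n)) → z ∈ N)
    (hN_proper : N ≠ Set.univ)
    (f : M → A)
    (hf_mem : ∀ v ∈ N, f v ∈ V)
    (hf_add : ∀ v ∈ N, ∀ w ∈ N, f (v + w) = f v + f w)
    (hf_smul : ∀ u ∈ U, ∀ v ∈ N, f (smul u v) = u * f v)
    (p : M → A)
    (hp_mem : ∀ v : M, p v ∈ V)
    (hp_nonneg : ∀ v : M, 0 ≤ p v)
    (hp_add : ∀ v w : M, p (v + w) ≤ p v + p w)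
    (hp_smul : ∀ u ∈ U, 0 ≤ u → ∀ v : M, p (smul u v) = u * p v)
    (hfp : ∀ v ∈ N, f v ≤ p v) :
    ∃ g : M → A,
      (∀ v : M, g v ∈ V) ∧
      (∀ v w : M, g (v + w) = g v + g w) ∧
      (∀ u ∈ U, ∀ v : M, g (smul u v) = u * g v) ∧
      (∀ v ∈ N, g v = f v) ∧
      ∀ v : M, g v ≤ p v := by
  have hU := hstr.U_falg
  have hcomplete : ∀ S : Set A, S.Nonempty → BddAbove S → ∃ a, IsLUB S a := by
    rintro S hS ⟨b, hb⟩
    obtain ⟨a, -, -, ha, -⟩ := hCR_ambient.1 S (Set.subset_univ S) hS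
      ⟨b, Set.mem_univ b, fun t ht => hb ht⟩
    exact ⟨a, fun t ht => ha.2.1 t ht, fun c hc => ha.2.2 c (Set.mem_univ c) fun t ht => hc ht⟩
  let _ : Module ℝ M := hM.realModule hU
  let F : M →ₗ.[ℝ] A :=
    { domain :=
        { carrier := N
          add_mem' := fun ha hb => hN_add _ ha _ hb
          zero_mem' := hN_zero
          smul_mem' := fun r v hv => hN_smul _ (hU.smul_one_mem r) v hv }
      toFun :=
        { toFun := fun x => f x
          map_add' := fun x y => hf_add x x.2 y y.2
          map_smul' := fun r x => (hf_smul _ (hU.smul_one_mem r) x x.2).trans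
            (FAlgebra.smul_one_mul r _) } }
  obtain ⟨g, hgf, hgp⟩ := F.exists_extension_of_le_sublinear hcomplete p hp_add
    (fun r hr v => (hp_smul _ (hU.smul_one_mem r)
      (FAlgebra.smul_nonneg' r 1 hr (by simpa using FAlgebra.mul_self_nonneg (1 : A))) v).trans
      (FAlgebra.smul_one_mul r _))
    (fun x => hfp x x.2)
  have hg_mem : ∀ v, g v ∈ V := fun v => by
    have hw : p v + p (-v) ∈ V := hstr.V_riesz.add_mem _ (hp_mem _) _ (hp_mem _)
    refine hstr.V_solid _ _ hw (sup_le ?_ ?_)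
    · exact ((hgp v).trans (le_add_of_nonneg_right (hp_nonneg _))).trans le_sup_left
    · rw [← map_neg]
      exact ((hgp (-v)).trans (le_add_of_nonneg_left (hp_nonneg _))).trans le_sup_left
  exact ⟨g, hg_mem, map_add g, fun u hu v => hM.map_smul_of_le_sublinear hstr hp_mem hp_nonneg
    hp_add hp_smul hg_mem (map_add g) (map_smul g) hgp hu v, fun v hv => hgf ⟨v, hv⟩, hgp⟩
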